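/- Let Δ ⊂ ℝ^d be a lattice simplex of dimension d with vertices v_1, …, v_{d+1} ∈ ℤ^d and let k ≥ 3 be an integer. Assume that no α ∈ Λ_Δ satisfies k+1 ≤ ht(α) ≤ 2k. Let S = ⋃ { supp(α) : α ∈ Λ_Δ, ht(α) ≤ k } ⊆ {1,…,d+1}. Then for every α ∈ Λ_Δ one has supp(α) ⊆ S if and only if ht(α) ≤ k. -/

import Mathlib

open scoped Pointwise

/-- The coercion of an integer point to a real point. -/
def toReal {d : ℕ} (x : Fin d → ℤ) : Fin d → ℝ := fun i => (x i : ℝ)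

/-- The number of lattice points in the `n`-th dilation of `P ⊆ ℝ^d`. -/
noncomputable def latticeCount {d : ℕ} (P : Set (Fin d → ℝ)) (n : ℕ) : ℕ :=
  Set.ncard {x : Fin d → ℤ | toReal x ∈ (n : ℝ) • P}

/-- The finite abelian group `Λ_Δ` attached to a lattice simplex with vertices `v`. -/
def Lambda {d : ℕ} (v : Fin (d + 1) → Fin d → ℤ) : Set (Fin (d + 1) → ℝ) :=
  {r | (∀ j, 0 ≤ r j ∧ r j < 1) ∧
    (∀ i : Fin d, ∃ z : ℤ, ∑ j, r j * (v j i : ℝ) = (z : ℝ)) ∧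
    (∃ z : ℤ, ∑ j, r j = (z : ℝ))}

/-- The height `ht(α) = ∑ᵢ αᵢ`. -/
def ht {m : ℕ} (α : Fin m → ℝ) : ℝ := ∑ i, α i

/-- The support `supp(α) = {i : αᵢ > 0}`. -/
def suppOf {m : ℕ} (α : Fin m → ℝ) : Set (Fin m) := {i | 0 < α i}

/-- Addition on `Λ_Δ`: coordinatewise fractional part of the sum. -/
noncomputable def fadd {m : ℕ} (α β : Fin m → ℝ) : Fin m → ℝ := fun i => Int.fract (α i + β i)

/-- Negation on `Λ_Δ`: coordinatewise fractional part of `1 - αᵢ`. -/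
noncomputable def fneg {m : ℕ} (α : Fin m → ℝ) : Fin m → ℝ := fun i => Int.fract (1 - α i)

/-- `P ⊆ ℝ^d` is a lattice polytope of dimension `d`: the convex hull of a finite
set of lattice points whose affine span is all of `ℝ^d`. -/
def IsFullDimLatticePolytope {d : ℕ} (P : Set (Fin d → ℝ)) : Prop :=
  ∃ V : Finset (Fin d → ℤ),
    P = convexHull ℝ (toReal '' (V : Set (Fin d → ℤ))) ∧ affineSpan ℝ P = ⊤

theorem fract_mem_Lambda {d : ℕ} (v : Fin (d + 1) → Fin d → ℤ) (r : Fin (d + 1) → ℝ)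
    (h₁ : ∀ i : Fin d, ∃ z : ℤ, ∑ j, r j * (v j i : ℝ) = (z : ℝ))
    (h₂ : ∃ z : ℤ, ∑ j, r j = (z : ℝ)) : (fun j => Int.fract (r j)) ∈ Lambda v := by
  refine ⟨fun j => ⟨Int.fract_nonneg _, Int.fract_lt_one _⟩, fun i => ?_, ?_⟩
  · obtain ⟨z, hz⟩ := h₁ i
    refine ⟨z - ∑ j, ⌊r j⌋ * v j i, ?_⟩
    push_cast
    rw [← hz, ← Finset.sum_sub_distrib]
    exact Finset.sum_congr rfl fun j _ => by rw [Int.fract]; ring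
  · obtain ⟨z, hz⟩ := h₂
    refine ⟨z - ∑ j, ⌊r j⌋, ?_⟩
    push_cast
    rw [← hz, ← Finset.sum_sub_distrib]
    rfl

theorem zero_mem_Lambda {d : ℕ} (v : Fin (d + 1) → Fin d → ℤ) : 0 ∈ Lambda v :=
  ⟨fun _ => by simp, fun _ => ⟨0, by simp⟩, ⟨0, by simp⟩⟩

theorem fadd_mem_Lambda {d : ℕ} {v : Fin (d + 1) → Fin d → ℤ} {α β : Fin (d + 1) → ℝ}
    (hα : α ∈ Lambda v) (hβ : β ∈ Lambda v) : fadd α β ∈ Lambda v := by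
  refine fract_mem_Lambda v (fun j => α j + β j) (fun i => ?_) ?_
  · obtain ⟨a, ha⟩ := hα.2.1 i
    obtain ⟨b, hb⟩ := hβ.2.1 i
    exact ⟨a + b, by simp [add_mul, Finset.sum_add_distrib, ha, hb]⟩
  · obtain ⟨a, ha⟩ := hα.2.2
    obtain ⟨b, hb⟩ := hβ.2.2
    exact ⟨a + b, by simp [Finset.sum_add_distrib, ha, hb]⟩

theorem fneg_mem_Lambda {d : ℕ} {v : Fin (d + 1) → Fin d → ℤ} {α : Fin (d + 1) → ℝ}
    (hα : α ∈ Lambda v) : fneg α ∈ Lambda v := by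
  refine fract_mem_Lambda v (fun j => 1 - α j) (fun i => ?_) ?_
  · obtain ⟨a, ha⟩ := hα.2.1 i
    exact ⟨∑ j, v j i - a, by simp [sub_mul, Finset.sum_sub_distrib, ha]⟩
  · obtain ⟨a, ha⟩ := hα.2.2
    exact ⟨d + 1 - a, by simp [Finset.sum_sub_distrib, ha]⟩

theorem ht_fadd_le {m : ℕ} {α β : Fin m → ℝ} (hα : ∀ i, 0 ≤ α i) (hβ : ∀ i, 0 ≤ β i) :
    ht (fadd α β) ≤ ht α + ht β := by
  rw [ht, ht, ht, ← Finset.sum_add_distrib]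
  refine Finset.sum_le_sum fun i _ => ?_
  have h : (0 : ℤ) ≤ ⌊α i + β i⌋ := Int.floor_nonneg.2 (add_nonneg (hα i) (hβ i))
  have h' : (0 : ℝ) ≤ ⌊α i + β i⌋ := by exact_mod_cast h
  rw [fadd, Int.fract]
  linarith

theorem fract_one_sub_of_pos {a : ℝ} (h₀ : 0 < a) (h₁ : a < 1) : Int.fract (1 - a) = 1 - a :=
  Int.fract_eq_self.2 ⟨by linarith, by linarith⟩

open Classical in
theorem ht_add_ht_fneg {m : ℕ} {α : Fin m → ℝ} (hα : ∀ i, 0 ≤ α i ∧ α i < 1) :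
    ht α + ht (fneg α) = (Finset.univ.filter fun i => 0 < α i).card := by
  rw [ht, ht, ← Finset.sum_add_distrib, Finset.card_filter]
  push_cast
  refine Finset.sum_congr rfl fun i _ => ?_
  rcases (hα i).1.eq_or_lt with h | h
  · simp [fneg, ← h]
  · simp [fneg, fract_one_sub_of_pos h (hα i).2, h]

theorem fneg_fneg {m : ℕ} {α : Fin m → ℝ} (hα : ∀ i, 0 ≤ α i ∧ α i < 1) :
    fneg (fneg α) = α := by
  funext i
  rcases (hα i).1.eq_or_lt with h | h
  · simp [fneg, ← h]
  · rw [fneg, fneg, fract_one_sub_of_pos h (hα i).2, sub_sub_cancel]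
    exact Int.fract_eq_self.2 (hα i)

theorem eq_fneg_of_fadd_eq_zero {m : ℕ} {α β : Fin m → ℝ} (hβ : ∀ i, 0 ≤ β i ∧ β i < 1)
    (h : fadd α β = 0) : β = fneg α := by
  funext i
  have hi : Int.fract (α i + β i) = 0 := congrFun h i
  obtain ⟨z, hz⟩ := Int.fract_eq_zero_iff.1 hi
  rw [← Int.fract_eq_self.2 (hβ i), fneg, Int.fract_eq_fract]
  exact ⟨z - 1, by push_cast; linarith⟩

theorem eq_of_fadd_eq {m : ℕ} {α β γ : Fin m → ℝ} (hβ : ∀ i, 0 ≤ β i ∧ β i < 1)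
    (hγ : ∀ i, 0 ≤ γ i ∧ γ i < 1) (h : fadd α β = fadd α γ) : β = γ := by
  funext i
  obtain ⟨z, hz⟩ := Int.fract_eq_fract.1 (congrFun h i)
  rw [← Int.fract_eq_self.2 (hβ i), ← Int.fract_eq_self.2 (hγ i), Int.fract_eq_fract]
  exact ⟨z, by linarith⟩

theorem finite_Lambda {d : ℕ} {v : Fin (d + 1) → Fin d → ℤ}
    (hv : AffineIndependent ℝ (fun j => toReal (v j))) : (Lambda v).Finite := by
  classical
  let f : (Fin (d + 1) → ℝ) → (Fin d → ℤ) × ℤ :=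
    fun r => (fun i => ⌊∑ j, r j * (v j i : ℝ)⌋, ⌊∑ j, r j⌋)
  let b : (Fin d → ℤ) × ℤ := (fun i => ∑ j, |v j i|, (d + 1 : ℤ))
  refine Set.Finite.of_injOn (f := f) (t := Set.Icc (-b) b) ?_ ?_ (Set.finite_Icc _ _)
  · intro r hr
    have habs : ∀ i, |∑ j, r j * (v j i : ℝ)| ≤ ((∑ j, |v j i| : ℤ) : ℝ) := fun i => by
      push_cast
      refine (Finset.abs_sum_le_sum_abs _ _).trans (Finset.sum_le_sum fun j _ => ?_)
      rw [abs_mul, abs_of_nonneg (hr.1 j).1]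
      exact mul_le_of_le_one_left (abs_nonneg _) (hr.1 j).2.le
    have h₀ : 0 ≤ ∑ j, r j := Finset.sum_nonneg fun j _ => (hr.1 j).1
    have h₁ : ∑ j, r j ≤ ((d + 1 : ℤ) : ℝ) := by
      refine (Finset.sum_le_sum fun j _ => (hr.1 j).2.le).trans ?_
      simp
    refine ⟨⟨fun i => ?_, ?_⟩, ⟨fun i => ?_, ?_⟩⟩
    · refine Int.le_floor.2 ?_
      have := (abs_le.1 (habs i)).1
      simpa [b] using this
    · refine Int.le_floor.2 ?_
      simp only [b, Prod.snd_neg]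
      push_cast
      linarith [Nat.cast_nonneg (α := ℝ) d]
    · exact Int.cast_le.1 ((Int.floor_le _).trans (abs_le.1 (habs i)).2)
    · exact Int.cast_le.1 ((Int.floor_le _).trans h₁)
  · intro r hr s hs hrs
    have hfloor : ∀ x y : ℝ, (∃ z : ℤ, x = z) → (∃ z : ℤ, y = z) → ⌊x⌋ = ⌊y⌋ → x = y := by
      rintro _ _ ⟨x, rfl⟩ ⟨y, rfl⟩ h
      simpa using h
    have h₁ : ∀ i, ∑ j, r j * (v j i : ℝ) = ∑ j, s j * (v j i : ℝ) := fun i =>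
      hfloor _ _ (hr.2.1 i) (hs.2.1 i) (congrFun (congrArg Prod.fst hrs) i)
    have h₂ : ∑ j, r j = ∑ j, s j := hfloor _ _ hr.2.2 hs.2.2 (congrArg Prod.snd hrs)
    have h := affineIndependent_iff.1 hv Finset.univ (r - s)
      (by simp [Finset.sum_sub_distrib, h₂])
      (by
        funext i
        simp [toReal, Finset.sum_apply, sub_mul, Finset.sum_sub_distrib, h₁])
    exact funext fun j => sub_eq_zero.1 (h j (Finset.mem_univ j))

open Classical in
/-- In a finite translation-closed family `H`, every coordinate in the union of the supports is
nonzero on at least half of `H`. -/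
theorem card_le_two_mul_card_filter_pos {m : ℕ} {H : Finset (Fin m → ℝ)}
    (hH : ∀ α ∈ H, ∀ i, 0 ≤ α i ∧ α i < 1) (hadd : ∀ α ∈ H, ∀ β ∈ H, fadd α β ∈ H)
    {α : Fin m → ℝ} (hα : α ∈ H) {i : Fin m} (hi : 0 < α i) :
    H.card ≤ 2 * (H.filter fun β => 0 < β i).card := by
  have hle : (H.filter fun β => ¬ 0 < β i).card ≤ (H.filter fun β => 0 < β i).card := by
    refine Finset.card_le_card_of_injOn (fadd α) (fun β hβ => ?_) fun β hβ γ hγ h => ?_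
    · obtain ⟨hβ, hβi⟩ := Finset.mem_filter.1 hβ
      have h0 : β i = 0 := le_antisymm (not_lt.1 hβi) (hH β hβ i).1
      refine Finset.mem_filter.2 ⟨hadd α hα β hβ, ?_⟩
      rw [fadd, h0, add_zero, Int.fract_eq_self.2 (hH α hα i)]
      exact hi
    · exact eq_of_fadd_eq (hH β (Finset.mem_filter.1 hβ).1) (hH γ (Finset.mem_filter.1 hγ).1) h
  have := H.card_filter_add_card_filter_not (fun β => 0 < β i)
  omega

theorem fneg_mem_of_fadd_mem {m : ℕ} {H : Finset (Fin m → ℝ)}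
    (hH : ∀ α ∈ H, ∀ i, 0 ≤ α i ∧ α i < 1) (hzero : 0 ∈ H)
    (hadd : ∀ α ∈ H, ∀ β ∈ H, fadd α β ∈ H) {α : Fin m → ℝ} (hα : α ∈ H) : fneg α ∈ H := by
  obtain ⟨β, hβ, h⟩ := Finset.surjOn_of_injOn_of_card_le (fadd α) (hadd α hα)
    (fun β hβ γ hγ h => eq_of_fadd_eq (hH β hβ) (hH γ hγ) h) le_rfl hzero
  exact eq_fneg_of_fadd_eq_zero (hH β hβ) h ▸ hβ

open Classical in
/-- A finite translation-closed family of elements of height at most `k` is supported on at most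
`4 * k` coordinates. -/
theorem card_le_four_mul_of_ht_le {m k : ℕ} {H : Finset (Fin m → ℝ)}
    (hH : ∀ α ∈ H, ∀ i, 0 ≤ α i ∧ α i < 1) (hzero : 0 ∈ H)
    (hadd : ∀ α ∈ H, ∀ β ∈ H, fadd α β ∈ H) (hht : ∀ α ∈ H, ht α ≤ (k : ℝ)) {S : Finset (Fin m)}
    (hS : ∀ i ∈ S, ∃ α ∈ H, 0 < α i) : S.card ≤ 4 * k := by
  have hsupp : ∀ β ∈ H, (S.filter fun i => 0 < β i).card ≤ 2 * k := fun β hβ => by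
    refine (Finset.card_le_card (Finset.filter_subset_filter _ (Finset.subset_univ S))).trans ?_
    have h := ht_add_ht_fneg (hH β hβ)
    have h₁ := hht β hβ
    have h₂ := hht _ (fneg_mem_of_fadd_mem hH hzero hadd hβ)
    have : ((Finset.univ.filter fun i => 0 < β i).card : ℝ) ≤ 2 * k := by linarith
    exact_mod_cast this
  have hcount : ∑ i ∈ S, (H.filter fun β => 0 < β i).card
      = ∑ β ∈ H, (S.filter fun i => 0 < β i).card := by
    simp only [Finset.card_filter]
    exact Finset.sum_comm
  have hlow : S.card * H.card ≤ ∑ i ∈ S, 2 * (H.filter fun β => 0 < β i).card := by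
    rw [← smul_eq_mul]
    refine Finset.card_nsmul_le_sum _ _ _ fun i hi => ?_
    obtain ⟨α, hα, hαi⟩ := hS i hi
    exact card_le_two_mul_card_filter_pos hH hadd hα hαi
  have hup : ∑ β ∈ H, (S.filter fun i => 0 < β i).card ≤ H.card * (2 * k) := by
    rw [← smul_eq_mul]
    exact Finset.sum_le_card_nsmul _ _ _ hsupp
  rw [← Finset.mul_sum, hcount] at hlow
  have hpos : 0 < H.card := Finset.card_pos.2 ⟨0, hzero⟩
  refine Nat.le_of_mul_le_mul_right (hlow.trans ((Nat.mul_le_mul_left 2 hup).trans_eq ?_)) hpos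
  ring

theorem ht_le_of_ht_le_two_mul {d k : ℕ} {v : Fin (d + 1) → Fin d → ℤ}
    (hvanish : ∀ α ∈ Lambda v, ¬((k : ℝ) + 1 ≤ ht α ∧ ht α ≤ 2 * (k : ℝ)))
    {α : Fin (d + 1) → ℝ} (hα : α ∈ Lambda v) (h : ht α ≤ 2 * (k : ℝ)) : ht α ≤ k := by
  by_contra! hlt
  refine hvanish α hα ⟨?_, h⟩
  obtain ⟨z, hz⟩ := hα.2.2
  rw [ht, hz] at hlt ⊢
  have : (k : ℤ) < z := by exact_mod_cast hlt
  exact_mod_cast this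

/-- with `S = ⋃ {supp(α) : α ∈ Λ_Δ, ht(α) ≤ k}`, an element `α ∈ Λ_Δ`
satisfies `supp(α) ⊆ S` if and only if `ht(α) ≤ k`. -/
theorem stmt1 (d k : ℕ) (hk : 3 ≤ k) (v : Fin (d + 1) → Fin d → ℤ)
    (hv : AffineIndependent ℝ (fun j => toReal (v j)))
    (hvanish : ∀ α ∈ Lambda v, ¬((k : ℝ) + 1 ≤ ht α ∧ ht α ≤ 2 * (k : ℝ))) :
    ∀ α ∈ Lambda v,
      suppOf α ⊆ (⋃ β ∈ {β | β ∈ Lambda v ∧ ht β ≤ (k : ℝ)}, suppOf β) ↔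
        ht α ≤ (k : ℝ) := by
  classical
  intro α hα
  constructor
  · intro hsub
    let H : Finset (Fin (d + 1) → ℝ) := (finite_Lambda hv).toFinset.filter fun β => ht β ≤ k
    have hmem : ∀ β, β ∈ H ↔ β ∈ Lambda v ∧ ht β ≤ k := fun β => by simp [H]
    have hH : ∀ β ∈ H, ∀ i, 0 ≤ β i ∧ β i < 1 := fun β hβ => ((hmem β).1 hβ).1.1
    have hzero : 0 ∈ H := (hmem 0).2 ⟨zero_mem_Lambda v, by simp [ht]⟩
    have hadd : ∀ β ∈ H, ∀ γ ∈ H, fadd β γ ∈ H := fun β hβ γ hγ => by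
      have hmemΛ := fadd_mem_Lambda ((hmem β).1 hβ).1 ((hmem γ).1 hγ).1
      have hle := ht_fadd_le (fun i => (hH β hβ i).1) (fun i => (hH γ hγ i).1)
      exact (hmem _).2 ⟨hmemΛ, ht_le_of_ht_le_two_mul hvanish hmemΛ
        (by linarith [((hmem β).1 hβ).2, ((hmem γ).1 hγ).2])⟩
    have hcard : (Finset.univ.filter fun i => 0 < α i).card ≤ 4 * k := by
      refine card_le_four_mul_of_ht_le hH hzero hadd (fun β hβ => ((hmem β).1 hβ).2) fun i hi => ?_
      obtain ⟨β, hβ, hi⟩ := Set.mem_iUnion₂.1 (hsub (Finset.mem_filter.1 hi).2)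
      exact ⟨β, (hmem β).2 hβ, hi⟩
    have hcard' : ((Finset.univ.filter fun i => 0 < α i).card : ℝ) ≤ 4 * k := by
      exact_mod_cast hcard
    rcases le_or_gt (ht α) (2 * k) with h | h
    · exact ht_le_of_ht_le_two_mul hvanish hα h
    · have hneg := fneg_mem_Lambda hα
      have hsum := ht_add_ht_fneg hα.1
      have hnegH : fneg α ∈ H :=
        (hmem _).2 ⟨hneg, ht_le_of_ht_le_two_mul hvanish hneg (by linarith)⟩
      have := fneg_mem_of_fadd_mem hH hzero hadd hnegH
      rw [fneg_fneg hα.1] at this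
      exact ((hmem α).1 this).2
  · exact fun h => Set.subset_biUnion_of_mem (u := suppOf) (show α ∈ {β | _} from ⟨hα, h⟩)
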